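/- arXiv:2603.16468 — 5 statements merged into one kernel-verified Lean document; each statement's English description precedes it below -/
import Mathlib

section
/- Let C > 0 and let ρ : ℝ → ℝ be a C^∞, strictly positive, 1-periodic function satisfying the Gauss–Bonnet normalization ∫₀¹ ρ(ξ)^(−1/3) dξ = 2πC. Suppose that for every ξ ∈ ℝ one has (8/135)·(ρ'(ξ)/ρ(ξ))³ − (11/135)·ρ'(ξ)ρ''(ξ)/ρ(ξ)² + (1/45)·ρ'''(ξ)/ρ(ξ) + (1/(180C²))·ρ'(ξ)/ρ(ξ)^(5/3) = 0. Then ρ is constant. -/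
open Real

/-- A solution `(p, q)` of the oscillator with half frequency in the angle `θ`, taking equal values
at two times between which `θ` advances by `2π`, vanishes identically. -/
theorem half_frequency_oscillator_eq_zero {p q θ h : ℝ → ℝ}
    (hp : ∀ x, HasDerivAt p (q x * h x) x) (hq : ∀ x, HasDerivAt q (-(p x * h x) / 4) x)
    (hθ : ∀ x, HasDerivAt θ (h x) x) (hθ0 : θ 0 = 0) (hθ1 : θ 1 = 2 * π)
    (hp1 : p 1 = p 0) (hq1 : q 1 = q 0) (x : ℝ) : p x = 0 := by
  have hhalf : ∀ x, HasDerivAt (fun x => θ x / 2) (h x / 2) x := fun x => (hθ x).div_const 2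
  have hF : ∀ x, HasDerivAt
      (fun x => p x * Real.cos (θ x / 2) - 2 * q x * Real.sin (θ x / 2)) 0 x := fun x => by
    refine (((hp x).mul (hhalf x).cos).sub
      (((hq x).const_mul 2).mul (hhalf x).sin)).congr_deriv ?_
    ring
  have hG : ∀ x, HasDerivAt
      (fun x => p x * Real.sin (θ x / 2) + 2 * q x * Real.cos (θ x / 2)) 0 x := fun x => by
    refine (((hp x).mul (hhalf x).sin).add
      (((hq x).const_mul 2).mul (hhalf x).cos)).congr_deriv ?_
    ring
  have hFc := is_const_of_deriv_eq_zero (fun x => (hF x).differentiableAt) (fun x => (hF x).deriv)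
  have hGc := is_const_of_deriv_eq_zero (fun x => (hG x).differentiableAt) (fun x => (hG x).deriv)
  have hpi : 2 * π / 2 = π := by ring
  have hF01 := hFc 1 0
  have hG01 := hGc 1 0
  have hFx := hFc x 0
  have hGx := hGc x 0
  simp only [hθ0, hθ1, hp1, hq1, hpi, zero_div, Real.cos_zero, Real.sin_zero, Real.cos_pi,
    Real.sin_pi] at hF01 hG01 hFx hGx
  have hp0 : p 0 = 0 := by linarith
  have hq0 : q 0 = 0 := by linarith
  rw [hp0, hq0] at hFx hGx
  linear_combination Real.cos (θ x / 2) * hFx + Real.sin (θ x / 2) * hGx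
    - p x * Real.sin_sq_add_cos_sq (θ x / 2)

theorem Function.Periodic.deriv {f : ℝ → ℝ} {c : ℝ} (hf : Function.Periodic f c) :
    Function.Periodic (deriv f) c := fun x => by
  rw [← deriv_comp_add_const, funext hf]

/-- If the radius of curvature `ρ` (in Lazutkin parametrization, 1-periodic,
smooth, positive, normalized by Gauss–Bonnet) satisfies the third-order ODE
coming from the vanishing of the Lazutkin normal-form coefficient `X₁`,
then `ρ` is constant. -/
theorem stmt_0 (C : ℝ) (hC : 0 < C) (ρ : ℝ → ℝ)
    (hρ : ContDiff ℝ (⊤ : ℕ∞) ρ) (hpos : ∀ ξ, 0 < ρ ξ)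
    (hper : Function.Periodic ρ 1)
    (hGB : ∫ ξ in (0:ℝ)..1, ρ ξ ^ (-(1:ℝ)/3) = 2 * π * C)
    (hODE : ∀ ξ : ℝ,
      (8/135) * (deriv ρ ξ / ρ ξ)^3
      - (11/135) * (deriv ρ ξ * deriv (deriv ρ) ξ / (ρ ξ)^2)
      + (1/45) * (deriv (deriv (deriv ρ)) ξ / ρ ξ)
      + (1/(180 * C^2)) * (deriv ρ ξ / ρ ξ ^ ((5:ℝ)/3)) = 0) :
    ∀ x y : ℝ, ρ x = ρ y := by
  have hC0 : C ≠ 0 := hC.ne'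
  have hne : ∀ x, ρ x ≠ 0 := fun x => (hpos x).ne'
  have hsm1 : ContDiff ℝ (⊤ : ℕ∞) (deriv ρ) := (contDiff_infty_iff_deriv.mp hρ).2
  have hsm2 : ContDiff ℝ (⊤ : ℕ∞) (deriv (deriv ρ)) := (contDiff_infty_iff_deriv.mp hsm1).2
  have h0 : ∀ x, HasDerivAt ρ (deriv ρ x) x :=
    fun x => (hρ.differentiable (by simp) x).hasDerivAt
  have h1 : ∀ x, HasDerivAt (deriv ρ) (deriv (deriv ρ) x) x :=
    fun x => (hsm1.differentiable (by simp) x).hasDerivAt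
  have h2 : ∀ x, HasDerivAt (deriv (deriv ρ)) (deriv (deriv (deriv ρ)) x) x :=
    fun x => (hsm2.differentiable (by simp) x).hasDerivAt
  have hcont : Continuous fun x => ρ x ^ (-(1:ℝ)/3) :=
    hρ.continuous.rpow_const fun x => Or.inl (hne x)
  -- up to a constant factor, `p` and `q` are the first two derivatives of `ρ ^ (-2/3)`
  -- with respect to the tangent angle
  let p : ℝ → ℝ := fun x => C * (deriv ρ x * ρ x ^ (-(4:ℝ)/3))
  let q : ℝ → ℝ := fun x => C ^ 2 * (deriv (deriv ρ) x / ρ x - 4 / 3 * (deriv ρ x / ρ x) ^ 2)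
  let h : ℝ → ℝ := fun x => ρ x ^ (-(1:ℝ)/3) / C
  let θ : ℝ → ℝ := fun x => (∫ ξ in (0:ℝ)..x, ρ ξ ^ (-(1:ℝ)/3)) / C
  have hp : ∀ x, HasDerivAt p (q x * h x) x := fun x => by
    refine (((h1 x).mul ((h0 x).rpow_const (Or.inl (hne x)))).const_mul C).congr_deriv ?_
    have e1 : ρ x ^ (-(4:ℝ)/3) = ρ x ^ (-(1:ℝ)/3) / ρ x := by
      rw [← Real.rpow_sub_one (hne x)]; norm_num
    have e2 : ρ x ^ (-(4:ℝ)/3 - 1) = ρ x ^ (-(1:ℝ)/3) / ρ x / ρ x := by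
      rw [Real.rpow_sub_one (hne x), e1]
    have := hne x
    simp only [q, h, e1, e2]
    field_simp
    ring
  have hq : ∀ x, HasDerivAt q (-(p x * h x) / 4) x := fun x => by
    refine ((((h2 x).div (h0 x) (hne x)).sub
      ((((h1 x).div (h0 x) (hne x)).pow 2).const_mul (4 / 3))).const_mul (C ^ 2)).congr_deriv ?_
    have e : deriv ρ x / ρ x ^ ((5:ℝ)/3)
        = deriv ρ x * (ρ x ^ (-(4:ℝ)/3) * ρ x ^ (-(1:ℝ)/3)) := by
      rw [← Real.rpow_add (hpos x), div_eq_mul_inv, ← Real.rpow_neg (hpos x).le]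
      norm_num
    have hx := hODE x
    rw [e] at hx
    have hph : p x * h x = deriv ρ x * (ρ x ^ (-(4:ℝ)/3) * ρ x ^ (-(1:ℝ)/3)) := by
      simp only [p, h]
      field_simp
    rw [← hph] at hx
    have := hne x
    have hx' : -(p x * h x) / 4 = 45 * C ^ 2 * ((8/135) * (deriv ρ x / ρ x)^3
      - (11/135) * (deriv ρ x * deriv (deriv ρ) x / (ρ x)^2)
      + (1/45) * (deriv (deriv (deriv ρ)) x / ρ x)) := by
      have hc : C ^ 2 * (1 / (180 * C ^ 2)) = 1 / 180 := by field_simp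
      linear_combination (-45 * C ^ 2) * hx + 45 * (p x * h x) * hc
    rw [hx']
    simp only [Pi.div_apply, Nat.add_one_sub_one, pow_one, Nat.cast_ofNat]
    field_simp
    ring
  have hθ : ∀ x, HasDerivAt θ (h x) x := fun x =>
    (hcont.integral_hasStrictDerivAt 0 x).hasDerivAt.div_const C
  have hθ1 : θ 1 = 2 * π := by
    simp only [θ, hGB]
    field_simp
  have e0 : ρ 1 = ρ 0 := by simpa using hper 0
  have e1 : deriv ρ 1 = deriv ρ 0 := by simpa using hper.deriv 0
  have e2 : deriv (deriv ρ) 1 = deriv (deriv ρ) 0 := by simpa using hper.deriv.deriv 0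
  have hp0 : ∀ x, p x = 0 := half_frequency_oscillator_eq_zero hp hq hθ (by simp [θ]) hθ1
    (by simp only [p, e0, e1]) (by simp only [q, e0, e1, e2])
  refine is_const_of_deriv_eq_zero (hρ.differentiable (by simp)) fun x => ?_
  have hr : ρ x ^ (-(4:ℝ)/3) ≠ 0 := (Real.rpow_pos_of_pos (hpos x) _).ne'
  simpa [p, hC0, hr] using hp0 x
end

section
/- Let C★ > 0 and T > 0. If h : ℝ → ℝ is a twice continuously differentiable, strictly positive, T-periodic solution of the differential equation h''(t) = −h(t)³ + C★·h(t) which satisfies the Gauss–Bonnet condition 2√2 · ∫₀ᵀ h(t) dt = 2π, then h is constant and equal to √C★. -/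
open Real

/-- With `θ' = √2 h`, the quantity `(h² - C) cos θ - √2 h' sin θ` is conserved along solutions of
`h'' = -h³ + C h`: the vector `(h² - C, √2 h')` rotates with angular speed `√2 h`. -/
theorem hasDerivAt_rotated_eq_zero {C h₁ s : ℝ} {h h' θ : ℝ → ℝ}
    (hh : HasDerivAt h (h' s) s) (hh' : HasDerivAt h' h₁ s) (hh₁ : h₁ = -(h s) ^ 3 + C * h s)
    (hθ : HasDerivAt θ (√2 * h s) s) :
    HasDerivAt (fun r => (h r ^ 2 - C) * cos (θ r) - √2 * h' r * sin (θ r)) 0 s := by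
  have hsq : √2 * √2 = (2 : ℝ) := Real.mul_self_sqrt (by norm_num)
  refine ((((hh.pow 2).sub_const C).mul hθ.cos).sub
    ((hh'.const_mul √2).mul hθ.sin)).congr_deriv ?_
  simp only [Pi.pow_apply]
  push_cast
  linear_combination -√2 * sin (θ s) * hh₁ - h' s * h s * cos (θ s) * hsq

/-- Uniqueness lemma: any strictly positive, `T`-periodic `C²` solution of
`h'' = -h³ + C★·h` satisfying the Gauss–Bonnet normalization
`2√2 ∫₀ᵀ h = 2π` is the constant `√C★`. -/
theorem stmt_1 (Cstar T : ℝ) (hCstar : 0 < Cstar) (hT : 0 < T)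
    (h : ℝ → ℝ) (hsm : ContDiff ℝ 2 h) (hpos : ∀ t, 0 < h t)
    (hper : Function.Periodic h T)
    (hODE : ∀ t, deriv (deriv h) t = -(h t)^3 + Cstar * h t)
    (hGB : 2 * Real.sqrt 2 * ∫ t in (0:ℝ)..T, h t = 2 * π) :
    ∀ t, h t = Real.sqrt Cstar := by
  intro t
  have hd : Differentiable ℝ h := hsm.differentiable (by norm_num)
  have hd' : Differentiable ℝ (deriv h) :=
    ((contDiff_succ_iff_deriv (n := 1)).1 hsm).2.2.differentiable (by norm_num)
  have hconst := is_const_of_deriv_eq_zero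
    (fun s => (hasDerivAt_rotated_eq_zero (hd s).hasDerivAt (hd' s).hasDerivAt (hODE s)
      ((hd.continuous.integral_hasStrictDerivAt t s).hasDerivAt.const_mul √2)).differentiableAt)
    (fun s => (hasDerivAt_rotated_eq_zero (hd s).hasDerivAt (hd' s).hasDerivAt (hODE s)
      ((hd.continuous.integral_hasStrictDerivAt t s).hasDerivAt.const_mul √2)).deriv)
    t (t + T)
  have hangle : √2 * ∫ r in t..t + T, h r = π := by
    rw [hper.intervalIntegral_add_eq t 0, zero_add]
    linarith
  simp only [intervalIntegral.integral_same, hangle, hper t, mul_zero, cos_zero, sin_zero, cos_pi,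
    sin_pi] at hconst
  rw [show Cstar = h t ^ 2 by linarith, Real.sqrt_sq (hpos t).le]
end

section
/- Let ζ : ℝ → ℝ be a non-constant, strictly positive, twice continuously differentiable periodic solution of ζ''(τ) = ζ(τ) − ζ(τ)³, and let T > 0 be its least positive period. Then 2√2 · ∫₀ᵀ ζ(τ) dτ = 4π. -/
open Real

/-- The vector field of `ζ'' = ζ - ζ³` in the phase plane is Lipschitz on vertical strips. -/
lemma lipschitzOnWith_duffing (M : NNReal) :
    LipschitzOnWith (1 + 3 * M ^ 2) (fun p : ℝ × ℝ ↦ (p.2, p.1 - p.1 ^ 3))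
      {p | |p.1| ≤ M} := by
  refine LipschitzOnWith.of_dist_le_mul fun p hp q hq ↦ ?_
  simp only [Set.mem_ofPred_eq] at hp hq
  have hM : (0 : ℝ) ≤ M := M.2
  have h1 : |p.1 - q.1| ≤ dist p q := by rw [Prod.dist_eq, ← Real.dist_eq]; exact le_max_left _ _
  have h2 : |p.2 - q.2| ≤ dist p q := by rw [Prod.dist_eq, ← Real.dist_eq]; exact le_max_right _ _
  have hK : ((1 + 3 * M ^ 2 : NNReal) : ℝ) = 1 + 3 * (M : ℝ) ^ 2 := by push_cast; ring
  have hd : 0 ≤ dist p q := dist_nonneg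
  rw [hK, Prod.dist_eq (x := (p.2, p.1 - p.1 ^ 3)), Real.dist_eq, Real.dist_eq]
  refine max_le (by nlinarith [mul_nonneg (sq_nonneg (M : ℝ)) hd]) ?_
  have hfac : p.1 - p.1 ^ 3 - (q.1 - q.1 ^ 3)
      = (p.1 - q.1) * (1 - (p.1 ^ 2 + p.1 * q.1 + q.1 ^ 2)) := by ring
  have hcoef : |1 - (p.1 ^ 2 + p.1 * q.1 + q.1 ^ 2)| ≤ 1 + 3 * (M : ℝ) ^ 2 := by
    have hp2 := sq_le_sq' (abs_le.mp hp).1 (abs_le.mp hp).2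
    have hq2 := sq_le_sq' (abs_le.mp hq).1 (abs_le.mp hq).2
    rw [abs_le]
    constructor <;> nlinarith [sq_nonneg (p.1 - q.1), sq_nonneg (p.1 + q.1)]
  rw [hfac, abs_mul, mul_comm]
  exact mul_le_mul hcoef h1 (abs_nonneg _) (by positivity)

/-- Two bounded solutions of `ζ'' = ζ - ζ³` with the same initial data coincide. -/
lemma duffing_unique {u u' w w' : ℝ → ℝ} {M : NNReal}
    (hu : ∀ t, HasDerivAt u (u' t) t) (hu' : ∀ t, HasDerivAt u' (u t - u t ^ 3) t)
    (hw : ∀ t, HasDerivAt w (w' t) t) (hw' : ∀ t, HasDerivAt w' (w t - w t ^ 3) t)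
    (huM : ∀ t, |u t| ≤ M) (hwM : ∀ t, |w t| ≤ M) {t₀ : ℝ}
    (h0 : u t₀ = w t₀) (h0' : u' t₀ = w' t₀) : u = w := by
  have key : (fun t ↦ (u t, u' t)) = fun t ↦ (w t, w' t) :=
    ODE_solution_unique_univ (v := fun _ (p : ℝ × ℝ) ↦ (p.2, p.1 - p.1 ^ 3))
      (s := fun _ ↦ {p : ℝ × ℝ | |p.1| ≤ M}) (t₀ := t₀) (fun _ ↦ lipschitzOnWith_duffing M)
      (fun t ↦ ⟨(hu t).prodMk (hu' t), huM t⟩) (fun t ↦ ⟨(hw t).prodMk (hw' t), hwM t⟩)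
      (by simp [h0, h0'])
  funext t
  exact congrArg Prod.fst (congrFun key t)

/-- A solution `(x, y)` of `x' = ω y`, `y' = -ω x`, rotated back by an angle `θ` with `θ' = ω`,
is constant. -/
lemma rotation_const {x y θ ω : ℝ → ℝ} (hx : ∀ t, HasDerivAt x (ω t * y t) t)
    (hy : ∀ t, HasDerivAt y (-(ω t * x t)) t) (hθ : ∀ t, HasDerivAt θ (ω t) t) (s t : ℝ) :
    x s * cos (θ s) - y s * sin (θ s) = x t * cos (θ t) - y t * sin (θ t) ∧
      x s * sin (θ s) + y s * cos (θ s) = x t * sin (θ t) + y t * cos (θ t) := by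
  have hA : ∀ t, HasDerivAt (fun t ↦ x t * cos (θ t) - y t * sin (θ t)) 0 t := fun t ↦
    (((hx t).mul (hθ t).cos).sub ((hy t).mul (hθ t).sin)).congr_deriv (by ring)
  have hB : ∀ t, HasDerivAt (fun t ↦ x t * sin (θ t) + y t * cos (θ t)) 0 t := fun t ↦
    (((hx t).mul (hθ t).sin).add ((hy t).mul (hθ t).cos)).congr_deriv (by ring)
  exact ⟨is_const_of_deriv_eq_zero (fun t ↦ (hA t).differentiableAt) (fun t ↦ (hA t).deriv) s t,
    is_const_of_deriv_eq_zero (fun t ↦ (hB t).differentiableAt) (fun t ↦ (hB t).deriv) s t⟩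

/-- For any non-constant, strictly positive, `C²` periodic solution of
`ζ'' = ζ - ζ³` with least positive period `T`, the turning angle
`2√2 ∫₀ᵀ ζ` equals `4π`. -/
theorem stmt_2 (ζ : ℝ → ℝ) (hsm : ContDiff ℝ 2 ζ) (hpos : ∀ τ, 0 < ζ τ)
    (hnc : ∃ a b : ℝ, ζ a ≠ ζ b)
    (hODE : ∀ τ, deriv (deriv ζ) τ = ζ τ - (ζ τ)^3)
    (T : ℝ) (hT : 0 < T) (hper : Function.Periodic ζ T)
    (hleast : ∀ T' : ℝ, 0 < T' → Function.Periodic ζ T' → T ≤ T') :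
    2 * Real.sqrt 2 * ∫ τ in (0:ℝ)..T, ζ τ = 4 * π := by
  have hcont : Continuous ζ := hsm.continuous
  have h1 : ∀ t, HasDerivAt ζ (deriv ζ t) t := fun t ↦
    (hsm.differentiable (by norm_num) t).hasDerivAt
  have hsm' : ContDiff ℝ 1 (deriv ζ) := (contDiff_succ_iff_deriv (n := 1).1 hsm).2.2
  have h2 : ∀ t, HasDerivAt (deriv ζ) (ζ t - ζ t ^ 3) t := fun t ↦
    hODE t ▸ (hsm'.differentiable (by norm_num) t).hasDerivAt
  have hs2 : √2 * √2 = 2 := Real.mul_self_sqrt (by norm_num)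
  -- In the coordinates `(ζ² - 1, √2 ζ')` the flow is a rotation with angular speed `√2 ζ`.
  set x : ℝ → ℝ := fun t ↦ ζ t ^ 2 - 1 with hxdef
  set y : ℝ → ℝ := fun t ↦ √2 * deriv ζ t with hydef
  set θ : ℝ → ℝ := fun t ↦ √2 * ∫ τ in (0:ℝ)..t, ζ τ with hθdef
  have hx : ∀ t, HasDerivAt x (√2 * ζ t * y t) t := fun t ↦
    (((h1 t).pow 2).sub_const 1).congr_deriv (by
      simp only [hydef]; push_cast; linear_combination (-ζ t * deriv ζ t) * hs2)
  have hy : ∀ t, HasDerivAt y (-(√2 * ζ t * x t)) t := fun t ↦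
    ((h2 t).const_mul √2).congr_deriv (by simp only [hxdef]; ring)
  have hθ : ∀ t, HasDerivAt θ (√2 * ζ t) t := fun t ↦
    (intervalIntegral.integral_hasDerivAt_right (hcont.intervalIntegrable _ _)
      (hcont.stronglyMeasurableAtFilter _ _) hcont.continuousAt).const_mul √2
  have hθ0 : θ 0 = 0 := by simp [hθdef]
  have hrot : ∀ t, x t * cos (θ t) - y t * sin (θ t) = x 0 ∧
      x t * sin (θ t) + y t * cos (θ t) = y 0 := fun t ↦ by
    simpa [hθ0] using rotation_const hx hy hθ t 0
  have hnorm : ∀ t, x t ^ 2 + y t ^ 2 = x 0 ^ 2 + y 0 ^ 2 := fun t ↦ by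
    rw [← (hrot t).1, ← (hrot t).2]
    linear_combination (-(x t ^ 2 + y t ^ 2)) * sin_sq_add_cos_sq (θ t)
  have hne : x 0 ^ 2 + y 0 ^ 2 ≠ 0 := fun h ↦ by
    have hone : ∀ t, ζ t = 1 := fun t ↦ by
      have hxt : x t = 0 := by
        have := hnorm t
        nlinarith [sq_nonneg (x t), sq_nonneg (y t)]
      simp only [hxdef] at hxt
      nlinarith [hpos t]
    obtain ⟨a, b, hab⟩ := hnc
    exact hab (by rw [hone, hone])
  have hperx : x T = x 0 := by simp only [hxdef, hper.eq]
  have hpery : y T = y 0 := by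
    have : deriv ζ T = deriv ζ 0 := by
      have h := deriv_comp_add_const ζ T 0
      rw [show (fun t ↦ ζ (t + T)) = ζ from funext hper, zero_add] at h
      exact h.symm
    simp only [hydef, this]
  have hcosT : cos (θ T) = 1 := by
    obtain ⟨hA, hB⟩ := hrot T
    rw [hperx, hpery] at hA hB
    have : (x 0 ^ 2 + y 0 ^ 2) * (cos (θ T) - 1) = 0 := by
      linear_combination x 0 * hA + y 0 * hB
    linarith [(mul_eq_zero.1 this).resolve_left hne]
  have hθT : 0 < θ T := mul_pos (by positivity)
    (intervalIntegral.intervalIntegral_pos_of_pos (hcont.intervalIntegrable _ _) hpos hT)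
  have h2π : 2 * π ≤ θ T := by
    by_contra! hlt
    exact hθT.ne' ((cos_eq_one_iff_of_lt_of_lt (by linarith [pi_pos]) hlt).1 hcosT)
  have hθcont : Continuous θ := continuous_iff_continuousAt.2 fun t ↦ (hθ t).continuousAt
  obtain ⟨S, ⟨hS0, hST⟩, hS⟩ := intermediate_value_Icc hT.le hθcont.continuousOn
    (show 2 * π ∈ Set.Icc (θ 0) (θ T) from ⟨by rw [hθ0]; positivity, h2π⟩)
  have hSpos : 0 < S := hS0.lt_of_ne fun h ↦ by
    rw [← h, hθ0] at hS
    exact two_pi_pos.ne hS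
  obtain ⟨hxS, hyS⟩ := hrot S
  simp only [hS, cos_two_pi, sin_two_pi, mul_one, mul_zero, sub_zero, zero_add] at hxS hyS
  have hζS : ζ S = ζ 0 := by
    simp only [hxdef] at hxS
    exact (pow_left_inj₀ (hpos S).le (hpos 0).le two_ne_zero).1 (by linarith)
  have hζS' : deriv ζ S = deriv ζ 0 := mul_left_cancel₀ (by positivity : √2 ≠ 0) hyS
  have hbound : ∀ t, |ζ t| ≤ (x 0 ^ 2 + y 0 ^ 2 + 3).toNNReal := fun t ↦ by
    rw [abs_of_pos (hpos t), Real.coe_toNNReal _ (by positivity), ← hnorm t]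
    simp only [hxdef]
    nlinarith [sq_nonneg (y t), sq_nonneg (ζ t - 1), sq_nonneg (ζ t ^ 2 - 2), hpos t]
  have hshift : (fun t ↦ ζ (t + S)) = ζ :=
    duffing_unique (t₀ := 0) (u' := fun t ↦ deriv ζ (t + S))
      (fun t ↦ (h1 (t + S)).comp_add_const t S) (fun t ↦ (h2 (t + S)).comp_add_const t S)
      h1 h2 (fun t ↦ hbound (t + S)) hbound (by simpa using hζS) (by simpa using hζS')
  have hTS : S = T := le_antisymm hST (hleast S hSpos (congrFun hshift))
  rw [hTS] at hS
  simp only [hθdef] at hS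
  linear_combination 2 * hS
end

section
/- For every E ∈ (0, 1/4), setting ζ₋ = √(1 − 2√E) and ζ₊ = √(1 + 2√E), the improper integral ∫_{ζ₋}^{ζ₊} ζ / √(2E − ½(ζ² − 1)²) dζ converges and 4√2 · ∫_{ζ₋}^{ζ₊} ζ / √(2E − ½(ζ² − 1)²) dζ = 4π. -/
open Real MeasureTheory

/-- The integrand of the turning-angle integral has the antiderivative
`arcsin ((ζ² - 1) / (2s)) / √2`, where `s = √E`. -/
lemma hasDerivAt_arcsin_turningAngle {s ζ : ℝ} (hs : 0 < s)
    (h₁ : 1 - 2 * s < ζ ^ 2) (h₂ : ζ ^ 2 < 1 + 2 * s) :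
    HasDerivAt (fun x : ℝ => arcsin ((x ^ 2 - 1) / (2 * s)) / √2)
      (ζ / √(2 * s ^ 2 - (1 / 2) * (ζ ^ 2 - 1) ^ 2)) ζ := by
  have hlo : -1 < (ζ ^ 2 - 1) / (2 * s) := by
    rw [lt_div_iff₀ (by positivity)]; linarith
  have hhi : (ζ ^ 2 - 1) / (2 * s) < 1 := by
    rw [div_lt_iff₀ (by positivity)]; linarith
  have hpos : 0 < 1 - ((ζ ^ 2 - 1) / (2 * s)) ^ 2 := by nlinarith
  have hu : HasDerivAt (fun x : ℝ => (x ^ 2 - 1) / (2 * s)) (2 * ζ / (2 * s)) ζ := by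
    simpa using ((hasDerivAt_pow 2 ζ).sub_const 1).div_const (2 * s)
  have hsqrt : √(2 * s ^ 2 - (1 / 2) * (ζ ^ 2 - 1) ^ 2)
      = √2 * s * √(1 - ((ζ ^ 2 - 1) / (2 * s)) ^ 2) := by
    rw [show 2 * s ^ 2 - (1 / 2) * (ζ ^ 2 - 1) ^ 2
        = 2 * s ^ 2 * (1 - ((ζ ^ 2 - 1) / (2 * s)) ^ 2) by field_simp,
      sqrt_mul (by positivity), sqrt_mul zero_le_two, sqrt_sq hs.le]
  have hne : √(1 - ((ζ ^ 2 - 1) / (2 * s)) ^ 2) ≠ 0 := (sqrt_pos.2 hpos).ne'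
  refine (((hasDerivAt_arcsin hlo.ne' hhi.ne).comp ζ hu).div_const (√2)).congr_deriv ?_
  rw [hsqrt]
  generalize √(1 - ((ζ ^ 2 - 1) / (2 * s)) ^ 2) = r at hne ⊢
  field_simp

/-- For `E ∈ (0, 1/4)`, the turning-angle integral between the positive
roots `ζ± = √(1 ± 2√E)` of `4E = (ζ² - 1)²` converges and equals `4π`
after multiplication by `4√2`. -/
theorem stmt_5 (E : ℝ) (hE : E ∈ Set.Ioo (0:ℝ) (1/4)) :
    IntervalIntegrable
      (fun ζ : ℝ => ζ / Real.sqrt (2*E - (1/2)*(ζ^2 - 1)^2))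
      volume (Real.sqrt (1 - 2 * Real.sqrt E)) (Real.sqrt (1 + 2 * Real.sqrt E)) ∧
    4 * Real.sqrt 2 *
      ∫ ζ in (Real.sqrt (1 - 2 * Real.sqrt E))..(Real.sqrt (1 + 2 * Real.sqrt E)),
        ζ / Real.sqrt (2*E - (1/2)*(ζ^2 - 1)^2) = 4 * π := by
  obtain ⟨hE₀, hE₁⟩ := hE
  have hs : 0 < √E := sqrt_pos.2 hE₀
  have hsq : √E ^ 2 = E := sq_sqrt hE₀.le
  have hs' : √E < 1 / 2 := by nlinarith
  have hle : √(1 - 2 * √E) ≤ √(1 + 2 * √E) := sqrt_le_sqrt (by linarith)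
  have hderiv : ∀ ζ ∈ Set.Ioo (√(1 - 2 * √E)) (√(1 + 2 * √E)),
      HasDerivAt (fun x : ℝ => arcsin ((x ^ 2 - 1) / (2 * √E)) / √2)
        (ζ / √(2 * E - (1 / 2) * (ζ ^ 2 - 1) ^ 2)) ζ := by
    rintro ζ ⟨h₁, h₂⟩
    have hζ : 0 < ζ := (sqrt_nonneg _).trans_lt h₁
    simpa only [hsq] using
      hasDerivAt_arcsin_turningAngle hs ((sqrt_lt' hζ).1 h₁) ((lt_sqrt hζ.le).1 h₂)
  have hcont : Continuous fun x : ℝ => arcsin ((x ^ 2 - 1) / (2 * √E)) / √2 := by fun_prop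
  have hint : IntervalIntegrable (fun ζ : ℝ => ζ / √(2 * E - (1 / 2) * (ζ ^ 2 - 1) ^ 2))
      volume (√(1 - 2 * √E)) (√(1 + 2 * √E)) := by
    refine intervalIntegral.intervalIntegrable_deriv_of_nonneg hcont.continuousOn ?_ ?_
    · simpa only [min_eq_left hle, max_eq_right hle] using hderiv
    · simp only [min_eq_left hle, max_eq_right hle]
      exact fun ζ hζ => div_nonneg ((sqrt_nonneg _).trans hζ.1.le) (sqrt_nonneg _)
  refine ⟨hint, ?_⟩
  rw [intervalIntegral.integral_eq_sub_of_hasDerivAt_of_le hle hcont.continuousOn hderiv hint,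
    sq_sqrt (by linarith), sq_sqrt (by linarith),
    show (1 + 2 * √E - 1) / (2 * √E) = 1 by field_simp; ring,
    show (1 - 2 * √E - 1) / (2 * √E) = -1 by field_simp; ring,
    arcsin_one, arcsin_neg_one]
  field_simp
  ring
end

section
/- Let C > 0, let ρ : ℝ → ℝ be C⁸ and strictly positive, let θ : ℝ → ℝ be differentiable with θ'(x) = ρ(x)^(−1/3)/C for all x, let A : ℝ → ℝ be C³, and fix ξ ∈ ℝ. For η ∈ ℝ set x₀(η) = ξ + A(ξ)η², x₊(η) = ξ + η + A(ξ+η)η², G(η) = ∫_{x₀(η)}^{x₊(η)} exp( i(θ(x) − θ(x₀(η))) ) · ρ(x)^(2/3) dx, and, for small η ≠ 0, Φ⁺(η) = arctan( Im G(η) / Re G(η) ), with Φ⁺(0) = 0. Then there exist real constants c₁ and c₃ such that, as η → 0, Φ⁺(η) = c₁·η + c₃·η³ + Φ₄·η⁴ + O(η⁵) — in particular the coefficient of η² in the expansion vanishes — where Φ₄ = (1/(4C·ρ(ξ)^(1/3)))·[ A''(ξ) + (8/135)(ρ'(ξ)/ρ(ξ))³ − (11/135)ρ'(ξ)ρ''(ξ)/ρ(ξ)²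 + (1/45)ρ'''(ξ)/ρ(ξ) + (1/(180C²))·ρ'(ξ)/ρ(ξ)^(5/3) ]. -/
open Real Filter Asymptotics

/-- The polynomial in `(s, η)` without monomials of `s`-degree `0`, whose monomials of total degree
`k` for `2 ≤ k ≤ 5` are `w j k * s ^ j * η ^ (k - j)`. -/
noncomputable def gradedPoly (w : ℕ → ℕ → ℝ) (s η : ℝ) : ℝ :=
  (w 1 2 * s * η + w 2 2 * s ^ 2)
    + (w 1 3 * s * η ^ 2 + w 2 3 * s ^ 2 * η + w 3 3 * s ^ 3)
    + (w 1 4 * s * η ^ 3 + w 2 4 * s ^ 2 * η ^ 2 + w 3 4 * s ^ 3 * η + w 4 4 * s ^ 4)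
    + (w 1 5 * s * η ^ 4 + w 2 5 * s ^ 2 * η ^ 3 + w 3 5 * s ^ 3 * η ^ 2 + w 4 5 * s ^ 4 * η
      + w 5 5 * s ^ 5)

theorem exists_gradedPoly_sub_eq (w : ℕ → ℕ → ℝ) (a b : ℝ) :
    ∃ Q : ℝ → ℝ → ℝ, Continuous (Function.uncurry Q) ∧ ∀ η c : ℝ,
      gradedPoly w (η + a * η ^ 2 + b * η ^ 3 + c * η ^ 4) η - gradedPoly w (a * η ^ 2) η
        = (w 1 2 + w 2 2) * η ^ 2
          + (w 1 3 + w 2 3 + w 3 3 + 2 * a * w 2 2) * η ^ 3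
          + (w 1 4 + w 2 4 + w 3 4 + w 4 4 + a * (2 * w 2 3 + 3 * w 3 3)
              + b * (w 1 2 + 2 * w 2 2)) * η ^ 4
          + (w 1 5 + w 2 5 + w 3 5 + w 4 5 + w 5 5 + a * (2 * w 2 4 + 3 * w 3 4 + 4 * w 4 4)
              + b * (w 1 3 + 2 * w 2 3 + 3 * w 3 3) + 3 * a ^ 2 * w 3 3
              + 2 * a * b * w 2 2 + c * (w 1 2 + 2 * w 2 2)) * η ^ 5
          + η ^ 6 * Q η c := by
  let z₁ : ℝ → ℝ → ℝ := fun η c => b + c * η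
  let z : ℝ → ℝ → ℝ := fun η c => a + η * z₁ η c
  let y : ℝ → ℝ → ℝ := fun η c => 1 + η * z η c
  refine ⟨fun η c =>
    w 2 2 * (2 * a * c + z₁ η c ^ 2)
    + (w 1 3 * c + w 2 3 * (2 * c + z₁ η c * (z η c + a))
      + w 3 3 * (3 * c + 3 * z₁ η c * (z η c + a) + z η c ^ 3))
    + (w 1 4 * z₁ η c + w 2 4 * (z₁ η c * (1 + y η c) + a * z η c)
      + w 3 4 * (z₁ η c * (1 + y η c + y η c ^ 2) + a * z η c * (2 + y η c))
      + w 4 4 * (z₁ η c * (1 + y η c + y η c ^ 2 + y η c ^ 3)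
        + a * z η c * (3 + 2 * y η c + y η c ^ 2)))
    + z η c * (w 1 5 + w 2 5 * (1 + y η c) + w 3 5 * (1 + y η c + y η c ^ 2)
      + w 4 5 * (1 + y η c + y η c ^ 2 + y η c ^ 3)
      + w 5 5 * (1 + y η c + y η c ^ 2 + y η c ^ 3 + y η c ^ 4))
    - (w 3 3 * a ^ 3 + w 2 4 * a ^ 2 + w 3 4 * a ^ 3 * η + w 4 4 * a ^ 4 * η ^ 2
      + w 1 5 * a + w 2 5 * a ^ 2 * η + w 3 5 * a ^ 3 * η ^ 2 + w 4 5 * a ^ 4 * η ^ 3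
      + w 5 5 * a ^ 5 * η ^ 4), ?_, ?_⟩
  · simp only [z₁, z, y]
    unfold Function.uncurry
    fun_prop
  · intro η c
    simp only [z₁, z, y, gradedPoly]
    ring

/-- Coefficients of the `s`-antiderivative of `chordIntegrand` in the form used by `gradedPoly`. -/
noncomputable def chordCoeff (t f : ℕ → ℝ) (a c₁ c₃ d : ℝ) : ℕ → ℕ → ℝ
  | 1, 2 => -(f 0 * c₁)
  | 2, 2 => f 0 * t 1 / 2
  | 1, 3 => -(f 0 * t 1 * a)
  | 2, 3 => -(f 1 * c₁) / 2
  | 3, 3 => (f 0 * t 2 + f 1 * t 1) / 3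
  | 1, 4 => -(f 0 * c₃) + f 0 * c₁ ^ 3 / 6
  | 2, 4 => (-(f 0 * t 1 * c₁ ^ 2 / 2) - f 1 * t 1 * a) / 2
  | 3, 4 => (f 0 * t 1 ^ 2 * c₁ / 2 - f 2 * c₁) / 3
  | 4, 4 => (f 0 * t 3 - f 0 * t 1 ^ 3 / 6 + f 1 * t 2 + f 2 * t 1) / 4
  | 1, 5 => f 0 * (c₁ ^ 2 * t 1 * a / 2 - t 2 * a ^ 2 - d)
  | 2, 5 => (f 1 * c₁ ^ 3 / 6 - f 0 * t 1 ^ 2 * c₁ * a - f 1 * c₃) / 2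
  | 3, 5 => (-(f 0 * (c₁ ^ 2 * t 2 - t 1 ^ 3 * a) / 2) - f 1 * t 1 * c₁ ^ 2 / 2
      - f 2 * t 1 * a) / 3
  | 4, 5 => (f 0 * t 1 * c₁ * t 2 + f 1 * t 1 ^ 2 * c₁ / 2 - f 3 * c₁) / 4
  | 5, 5 => (f 0 * t 4 - f 0 * t 1 ^ 2 * t 2 / 2 + f 1 * t 3 - f 1 * t 1 ^ 3 / 6 + f 2 * t 2
      + f 3 * t 1) / 5
  | _, _ => 0

/-- The terms of total degree at most `4` in `(s, η)` of
`sin (D s - D (a η²) - (c₁ η + c₃ η³ + d η⁴)) * F s`, where `t` and `f` are the Taylor coefficients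
of `D` and `F` at `0`. -/
noncomputable def chordIntegrand (t f : ℕ → ℝ) (a c₁ c₃ d s η : ℝ) : ℝ :=
  let u₁ := t 1 * s - c₁ * η
  let u₂ := t 2 * s ^ 2 - t 1 * a * η ^ 2
  let u₃ := t 3 * s ^ 3 - c₃ * η ^ 3 - u₁ ^ 3 / 6
  let u₄ := t 4 * s ^ 4 - (t 2 * a ^ 2 + d) * η ^ 4 - u₁ ^ 2 * u₂ / 2
  f 0 * u₁ + (f 0 * u₂ + f 1 * s * u₁) + (f 0 * u₃ + f 1 * s * u₂ + f 2 * s ^ 2 * u₁)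
    + (f 0 * u₄ + f 1 * s * u₃ + f 2 * s ^ 2 * u₂ + f 3 * s ^ 3 * u₁)

theorem hasDerivAt_gradedPoly_chordCoeff (t f : ℕ → ℝ) (a c₁ c₃ d s η : ℝ) :
    HasDerivAt (fun s => gradedPoly (chordCoeff t f a c₁ c₃ d) s η)
      (chordIntegrand t f a c₁ c₃ d s η) s := by
  have h (n : ℕ) := hasDerivAt_pow n s
  have h1 (c : ℝ) : HasDerivAt (fun s : ℝ => c * s) c s := by
    simpa using (hasDerivAt_id s).const_mul c
  have hn (c : ℝ) (n : ℕ) : HasDerivAt (fun s : ℝ => c * s ^ n) (c * (n * s ^ (n - 1))) s :=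
    (h n).const_mul c
  set w := chordCoeff t f a c₁ c₃ d with hw
  convert! ((((h1 (w 1 2)).mul_const η).add (hn (w 2 2) 2)).add
    ((((h1 (w 1 3)).mul_const (η ^ 2)).add ((hn (w 2 3) 2).mul_const η)).add
      (hn (w 3 3) 3))).add
    (((((h1 (w 1 4)).mul_const (η ^ 3)).add ((hn (w 2 4) 2).mul_const (η ^ 2))).add
      ((hn (w 3 4) 3).mul_const η)).add (hn (w 4 4) 4)) |>.add
    ((((((h1 (w 1 5)).mul_const (η ^ 4)).add ((hn (w 2 5) 2).mul_const (η ^ 3))).add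
      ((hn (w 3 5) 3).mul_const (η ^ 2))).add ((hn (w 4 5) 4).mul_const η)).add
      (hn (w 5 5) 5)) using 1
  simp only [hw, chordCoeff, chordIntegrand]
  push_cast
  ring

theorem gradedPoly_chordCoeff_sub_isBigO (t f : ℕ → ℝ) (a b c c₁ c₃ d : ℝ)
    (hc₁ : c₁ = t 1 / 2)
    (hc₃ : f 0 * c₃ = f 0 * t 3 / 4 + f 1 * t 2 / 4 + f 2 * t 1 / 12
      + f 0 * (t 1 * b / 2 + t 2 * a))
    (hd : f 0 * d = f 0 * t 1 * c / 2 + f 0 * t 4 / 5 - f 0 * t 2 * t 1 ^ 2 / 60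
      + f 1 * (t 3 / 5 - (c₃ - t 1 * b / 2 - t 2 * a) / 2 - t 1 ^ 3 / 480) + f 2 * t 2 / 5
      + 3 * f 3 * t 1 / 40)
    (h₁ : 4 * f 0 * t 2 + f 1 * t 1 = 0)
    (h₂ : 3 * f 1 * t 2 + 6 * f 0 * t 3 + f 2 * t 1 = 0)
    (c' : ℝ → ℝ) (hc' : (fun η => c' η - c) =O[nhds 0] fun η => η) :
    (fun η : ℝ => gradedPoly (chordCoeff t f a c₁ c₃ d)
        (η + a * η ^ 2 + b * η ^ 3 + c' η * η ^ 4) η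
      - gradedPoly (chordCoeff t f a c₁ c₃ d) (a * η ^ 2) η) =O[nhds 0] fun η => η ^ 6 := by
  obtain ⟨Q, hQ, hQe⟩ := exists_gradedPoly_sub_eq (chordCoeff t f a c₁ c₃ d) a b
  have hlim : Tendsto c' (nhds 0) (nhds c) := by
    have h0 : Tendsto (fun η => c' η - c) (nhds 0) (nhds 0) := hc'.trans_tendsto tendsto_id
    simpa using h0.add_const c
  have hQ1 : (fun η => Q η (c' η)) =O[nhds 0] fun _ => (1 : ℝ) :=
    ((hQ.tendsto (0, c)).comp (tendsto_id.prodMk_nhds hlim)).isBigO_one ℝ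
  have hsum : (fun η : ℝ => f 0 * t 1 / 2 * ((c' η - c) * η ^ 5) + η ^ 6 * Q η (c' η))
      =O[nhds 0] fun η => η ^ 6 := by
    refine IsBigO.add (IsBigO.const_mul_left ?_ _) ?_
    · exact (hc'.mul (isBigO_refl (fun η : ℝ => η ^ 5) (nhds 0))).congr_right
        fun η => (pow_succ' η 5).symm
    · simpa using (isBigO_refl (fun η : ℝ => η ^ 6) (nhds 0)).mul hQ1
  refine hsum.congr_left fun η => ?_
  rw [hQe]
  simp only [chordCoeff]
  subst hc₁
  linear_combination η ^ 4 * hc₃ + η ^ 5 * hd - (η ^ 3 / 12 + η ^ 5 * b / 4) * h₁ - η ^ 5 * a / 6 * h₂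

theorem isBigO_pow_of_le {α : Type*} {l : Filter α} {η g : α → ℝ} (hη : Tendsto η l (nhds 0))
    {j k : ℕ} (hg : g =O[l] fun x => η x ^ j) (hk : k ≤ j) : g =O[l] fun x => η x ^ k := by
  have h1 : (fun x => η x ^ (j - k)) =O[l] fun _ => (1 : ℝ) := (hη.pow (j - k)).isBigO_one ℝ
  refine hg.trans ((h1.mul (isBigO_refl (fun x => η x ^ k) l)).congr (fun x => ?_) fun x => ?_)
  · rw [← pow_add, Nat.sub_add_cancel hk]
  · rw [one_mul]

theorem isBigO_mul_pow_of_add_le {α : Type*} {l : Filter α} {η g h : α → ℝ}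
    (hη : Tendsto η l (nhds 0)) {j k m : ℕ} (hg : g =O[l] fun x => η x ^ j)
    (hh : h =O[l] fun x => η x ^ k) (hm : m ≤ j + k) :
    (fun x => g x * h x) =O[l] fun x => η x ^ m := by
  have h1 := hg.mul hh
  simp only [← pow_add] at h1
  exact isBigO_pow_of_le hη h1 hm

theorem sin_mul_sub_chordIntegrand_isBigO {α : Type*} {l : Filter α} {s η : α → ℝ}
    (hη : Tendsto η l (nhds 0)) (hs : s =O[l] η) (t f : ℕ → ℝ) (a c₁ c₃ d : ℝ) {D F : ℝ → ℝ}
    (hD : (fun x => D x - (t 1 * x + t 2 * x ^ 2 + t 3 * x ^ 3 + t 4 * x ^ 4))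
      =O[nhds 0] fun x => x ^ 5)
    (hF : (fun x => F x - (f 0 + f 1 * x + f 2 * x ^ 2 + f 3 * x ^ 3)) =O[nhds 0] fun x => x ^ 4) :
    (fun x => sin (D (s x) - D (a * η x ^ 2) - (c₁ * η x + c₃ * η x ^ 3 + d * η x ^ 4)) * F (s x)
      - chordIntegrand t f a c₁ c₃ d (s x) (η x)) =O[l] fun x => η x ^ 5 := by
  have weaken {g : α → ℝ} {j : ℕ} (k : ℕ) (hg : g =O[l] fun x => η x ^ j) (hk : k ≤ j) :
      g =O[l] fun x => η x ^ k :=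
    isBigO_pow_of_le hη hg hk
  have hηp (k : ℕ) : (fun x => η x ^ k) =O[l] fun x => η x ^ k := isBigO_refl _ _
  have hsp (k : ℕ) : (fun x => s x ^ k) =O[l] fun x => η x ^ k := hs.pow k
  have hs0 : Tendsto s l (nhds 0) := hs.trans_tendsto hη
  have hb0 : Tendsto (fun x => a * η x ^ 2) l (nhds 0) := by
    simpa using (hη.pow 2).const_mul a
  have hDs := (hD.comp_tendsto hs0).trans (hsp 5)
  have hFs := (hF.comp_tendsto hs0).trans (hsp 4)
  have hDb : (fun x => D (a * η x ^ 2) - (t 1 * (a * η x ^ 2) + t 2 * (a * η x ^ 2) ^ 2))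
      =O[l] fun x => η x ^ 5 := by
    have h0 := (hD.comp_tendsto hb0).trans
      (show _ =O[l] fun x => η x ^ 5 from weaken 5 (j := 10)
        (((hηp 10).const_mul_left (a ^ 5)).congr_left fun x => by simp; ring) (by norm_num))
    refine (h0.add (weaken 5 ((((hηp 6).const_mul_left (t 3 * a ^ 3))).add
      (weaken 6 ((hηp 8).const_mul_left (t 4 * a ^ 4)) (by norm_num))) (by norm_num))).congr_left
      fun x => ?_
    simp only [Function.comp_apply]
    ring
  set u₁ : α → ℝ := fun x => t 1 * s x - c₁ * η x with hu₁
  set u₂ : α → ℝ := fun x => t 2 * s x ^ 2 - t 1 * a * η x ^ 2 with hu₂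
  set v₃ : α → ℝ := fun x => t 3 * s x ^ 3 - c₃ * η x ^ 3 with hv₃
  set v₄ : α → ℝ := fun x => t 4 * s x ^ 4 - (t 2 * a ^ 2 + d) * η x ^ 4 with hv₄
  set u : α → ℝ := fun x =>
    D (s x) - D (a * η x ^ 2) - (c₁ * η x + c₃ * η x ^ 3 + d * η x ^ 4) with hu
  have o₁ : u₁ =O[l] fun x => η x ^ 1 := by
    simpa using ((hs.const_mul_left (t 1)).sub ((isBigO_refl η l).const_mul_left c₁))
  have o₂ : u₂ =O[l] fun x => η x ^ 2 := ((hsp 2).const_mul_left _).sub ((hηp 2).const_mul_left _)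
  have o₃ : v₃ =O[l] fun x => η x ^ 3 := ((hsp 3).const_mul_left _).sub ((hηp 3).const_mul_left _)
  have o₄ : v₄ =O[l] fun x => η x ^ 4 := ((hsp 4).const_mul_left _).sub ((hηp 4).const_mul_left _)
  have ou : (fun x => u x - (u₁ x + u₂ x + v₃ x + v₄ x)) =O[l] fun x => η x ^ 5 :=
    (hDs.sub hDb).congr_left fun x => by
      simp only [hu, hu₁, hu₂, hv₃, hv₄, Function.comp_apply]; ring
  have or : (fun x => u x - (u₁ x + u₂ x)) =O[l] fun x => η x ^ 3 :=
    (((weaken 3 ou (by norm_num)).add o₃).add (weaken 3 o₄ (by norm_num))).congr_left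
      fun x => by ring
  have ou1 : u =O[l] fun x => η x ^ 1 :=
    (((weaken 1 or (by norm_num)).add o₁).add (weaken 1 o₂ (by norm_num))).congr_left
      fun x => by ring
  have hu0 : Tendsto u l (nhds 0) := ou1.trans_tendsto (by simpa using hη)
  have hsin : (fun x => sin (u x) - (u x - u x ^ 3 / 6)) =O[l] fun x => η x ^ 5 := by
    have h1 : (fun x => sin (u x) - (u x - u x ^ 3 / 6)) =O[l] fun x => u x ^ 5 := by
      refine IsBigO.of_bound (1 / 100) ?_
      have : ∀ᶠ x in l, |u x| ≤ 1 :=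
        (hu0.abs.eventually (eventually_le_nhds (by simp)))
      filter_upwards [this] with x hx
      have := Real.sin_bound hx
      simp only [norm_eq_abs, abs_pow]
      linarith
    exact h1.trans (by simpa using ou1.pow 5)
  have mul {g h : α → ℝ} {j k : ℕ} (m : ℕ) (hg : g =O[l] fun x => η x ^ j)
      (hh : h =O[l] fun x => η x ^ k) (hm : m ≤ j + k) :
      (fun x => g x * h x) =O[l] fun x => η x ^ m := isBigO_mul_pow_of_add_le hη hg hh hm
  have o12 : (fun x => u₁ x + u₂ x) =O[l] fun x => η x ^ 1 := o₁.add (weaken 1 o₂ (by norm_num))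
  have hcube : (fun x => u x ^ 3 - (u₁ x ^ 3 + 3 * u₁ x ^ 2 * u₂ x)) =O[l] fun x => η x ^ 5 := by
    have h1 := mul 5 or (mul 2 ou1 ou1 (by norm_num)) (by norm_num)
    have h2 := mul 5 or (mul 2 ou1 o12 (by norm_num)) (by norm_num)
    have h3 := mul 5 or (mul 2 o12 o12 (by norm_num)) (by norm_num)
    have h4 := mul 5 o₁ (mul 4 o₂ o₂ (by norm_num)) (by norm_num)
    have h5 := mul 5 o₂ (mul 4 o₂ o₂ (by norm_num)) (by norm_num)
    refine ((((h1.add h2).add h3).add (h4.const_mul_left 3)).add h5).congr_left fun x => ?_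
    ring
  set q₃ : α → ℝ := fun x => v₃ x - u₁ x ^ 3 / 6 with hq₃
  set q₄ : α → ℝ := fun x => v₄ x - u₁ x ^ 2 * u₂ x / 2 with hq₄
  have oq₃ : q₃ =O[l] fun x => η x ^ 3 :=
    (o₃.sub ((mul 3 o₁ (mul 2 o₁ o₁ (by norm_num)) (by norm_num)).const_mul_left
      (1 / 6))).congr_left fun x => by simp only [hq₃]; ring
  have oq₄ : q₄ =O[l] fun x => η x ^ 4 :=
    (o₄.sub ((mul 4 (mul 2 o₁ o₁ (by norm_num)) o₂ (by norm_num)).const_mul_left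
      (1 / 2))).congr_left fun x => by simp only [hq₄]; ring
  have osin : (fun x => sin (u x) - (u₁ x + u₂ x + q₃ x + q₄ x)) =O[l] fun x => η x ^ 5 :=
    ((hsin.add ou).sub (hcube.const_mul_left (1 / 6))).congr_left fun x => by
      simp only [hq₃, hq₄]; ring
  have osin1 : (fun x => sin (u x)) =O[l] fun x => η x ^ 1 :=
    ((weaken 1 osin (by norm_num)).add (((o₁.add (weaken 1 o₂ (by norm_num))).add
      (weaken 1 oq₃ (by norm_num))).add (weaken 1 oq₄ (by norm_num)))).congr_left
      fun x => by ring
  have op : (fun x => f 0 + f 1 * s x + f 2 * s x ^ 2 + f 3 * s x ^ 3) =O[l]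
      fun x => η x ^ 0 := by
    have h1 (k : ℕ) : (fun x => f k * s x ^ k) =O[l] fun x => η x ^ 0 :=
      (weaken 0 (hsp k) (by norm_num)).const_mul_left _
    exact ((((h1 0).add (h1 1)).add (h1 2)).add (h1 3)).congr_left fun x => by ring
  have e1 := mul 5 osin1 hFs (by norm_num)
  have e2 := mul 5 osin op (by norm_num)
  have e3 := mul 5 o₂ ((hsp 3).const_mul_left (f 3)) (by norm_num)
  have e4 := mul 5 oq₃ (((hsp 2).const_mul_left (f 2)).add
    (weaken 2 ((hsp 3).const_mul_left (f 3)) (by norm_num))) (by norm_num)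
  have e5 := mul 5 oq₄ ((((hsp 1).const_mul_left (f 1)).add
    (weaken 1 ((hsp 2).const_mul_left (f 2)) (by norm_num))).add
    (weaken 1 ((hsp 3).const_mul_left (f 3)) (by norm_num))) (by norm_num)
  refine ((((e1.add e2).add e3).add e4).add e5).congr_left fun x => ?_
  simp only [chordIntegrand, hq₃, hq₄, hu₁, hu₂, hv₃, hv₄, Function.comp_apply]
  ring

/-- The filter of neighbourhoods of the origin inside the cone `|s| ≤ 2 |η|`. -/
def coneFilter : Filter (ℝ × ℝ) := nhds (0, 0) ⊓ 𝓟 {p | |p.1| ≤ 2 * |p.2|}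

theorem tendsto_snd_coneFilter : Tendsto Prod.snd coneFilter (nhds (0 : ℝ)) :=
  (continuous_snd.tendsto ((0, 0) : ℝ × ℝ)).mono_left inf_le_left

theorem fst_isBigO_snd_coneFilter : (Prod.fst : ℝ × ℝ → ℝ) =O[coneFilter] Prod.snd :=
  IsBigO.of_bound 2 (mem_inf_of_right (mem_principal.2 fun _ hp => hp))

theorem integral_isBigO_of_coneFilter {g : ℝ → ℝ → ℝ} {n : ℕ} {α β : ℝ → ℝ}
    (hg : (fun p : ℝ × ℝ => g p.1 p.2) =O[coneFilter] fun p => p.2 ^ n)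
    (hα : ∀ᶠ η in nhds (0 : ℝ), |α η| ≤ 2 * |η|) (hβ : ∀ᶠ η in nhds (0 : ℝ), |β η| ≤ 2 * |η|) :
    (fun η => ∫ s in α η..β η, g s η) =O[nhds 0] fun η => η ^ (n + 1) := by
  obtain ⟨K, hK0, hK⟩ := hg.exists_nonneg
  rw [isBigOWith_iff, coneFilter, eventually_inf_principal, Metric.eventually_nhds_iff] at hK
  obtain ⟨ε, hε, hK⟩ := hK
  have hsmall : ∀ᶠ η in nhds (0 : ℝ), 2 * |η| < ε :=
    (show Tendsto (fun η : ℝ => 2 * |η|) (nhds 0) (nhds 0) from by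
      simpa using ((continuous_abs.tendsto (0 : ℝ)).const_mul 2)).eventually (gt_mem_nhds hε)
  refine IsBigO.of_bound (K * 4) ?_
  filter_upwards [hα, hβ, hsmall] with η h1 h2 h3
  have hbound : ∀ s ∈ Set.uIoc (α η) (β η), ‖g s η‖ ≤ K * |η| ^ n := by
    intro s hs
    have hs' : |s| ≤ 2 * |η| := by
      rw [abs_le] at h1 h2 ⊢
      rcases Set.mem_uIoc.1 hs with h | h <;> constructor <;> linarith [h.1, h.2, h1.1, h2.1]
    have := hK (y := (s, η)) (by
      simp only [Prod.dist_eq, dist_zero_right, norm_eq_abs, sup_lt_iff]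
      exact ⟨by linarith, by linarith [abs_nonneg η]⟩) hs'
    simpa using this
  refine (intervalIntegral.norm_integral_le_of_norm_le_const hbound).trans ?_
  have h4 : |β η - α η| ≤ 4 * |η| := (abs_sub _ _).trans (by linarith)
  calc K * |η| ^ n * |β η - α η| ≤ K * |η| ^ n * (4 * |η|) := by gcongr
    _ = K * 4 * ‖η ^ (n + 1)‖ := by rw [norm_pow, norm_eq_abs]; ring

theorem abs_arctan_sub_arctan_le (x y : ℝ) : |arctan x - arctan y| ≤ |x - y| := by
  have h := Convex.norm_image_sub_le_of_norm_deriv_le (f := arctan) (C := 1) (s := Set.univ)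
    (x := y) (y := x) (fun z _ => (hasDerivAt_arctan z).differentiableAt) (fun z _ => by
      rw [(hasDerivAt_arctan z).deriv, norm_eq_abs, abs_of_nonneg (by positivity)]
      exact (div_le_one (by positivity)).2 (by nlinarith [sq_nonneg z])) convex_univ
    (Set.mem_univ _) (Set.mem_univ _)
  simpa using h

theorem arctan_div_sub_isBigO {R J T : ℝ → ℝ} (hT : Tendsto T (nhds 0) (nhds 0))
    (hT0 : T 0 = 0) (hR : (fun η : ℝ => η) =O[nhds 0] R) (hR0 : R 0 = 0) {n : ℕ}
    (hJ : (fun η => J η * cos (T η) - R η * sin (T η)) =O[nhds 0] fun η => η ^ (n + 1)) :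
    (fun η => arctan (J η / R η) - T η) =O[nhds 0] fun η => η ^ n := by
  obtain ⟨K, hK0, hK⟩ := hJ.exists_nonneg
  obtain ⟨M, hM0, hM⟩ := hR.exists_nonneg
  rw [isBigOWith_iff] at hK hM
  have hcos : ∀ᶠ η in nhds (0 : ℝ), 1 / 2 < cos (T η) := by
    have : Tendsto (fun η => cos (T η)) (nhds 0) (nhds 1) := by
      simpa [Function.comp_def] using (continuous_cos.tendsto 0).comp hT
    exact this.eventually (lt_mem_nhds (by norm_num))
  have hsm : ∀ᶠ η in nhds (0 : ℝ), |T η| < 1 := by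
    have h0 : Tendsto (fun η => |T η|) (nhds 0) (nhds 0) := by simpa using hT.abs
    exact h0.eventually (gt_mem_nhds one_pos)
  refine IsBigO.of_bound (2 * M * K) ?_
  filter_upwards [hK, hM, hcos, hsm] with η h1 h2 h3 h4
  simp only [norm_eq_abs, abs_pow] at h1 h2 ⊢
  rcases eq_or_ne η 0 with rfl | hη
  · simp only [hT0, hR0, div_zero, arctan_zero, sub_zero, abs_zero]
    positivity
  have hpos : 0 < |η| := abs_pos.2 hη
  have hRpos : 0 < |R η| := by
    by_contra h
    have : |R η| = 0 := le_antisymm (not_lt.1 h) (abs_nonneg _)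
    rw [this] at h2
    linarith
  have hRne : R η ≠ 0 := abs_pos.1 hRpos
  have htan : arctan (tan (T η)) = T η := by
    rw [abs_lt] at h4
    exact arctan_tan (by linarith [pi_gt_three]) (by linarith [pi_gt_three])
  have hc : 0 < cos (T η) := by linarith
  calc |arctan (J η / R η) - T η| = |arctan (J η / R η) - arctan (tan (T η))| := by rw [htan]
    _ ≤ |J η / R η - tan (T η)| := abs_arctan_sub_arctan_le _ _
    _ = |J η * cos (T η) - R η * sin (T η)| / (|R η| * cos (T η)) := by
        rw [← abs_of_pos hc, ← abs_mul, ← abs_div, abs_of_pos hc, tan_eq_sin_div_cos]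
        congr 1
        field_simp
    _ ≤ 2 * M * K * |η| ^ n := by
        rw [div_le_iff₀ (by positivity)]
        calc _ ≤ K * |η| ^ (n + 1) := h1
          _ = K * |η| ^ n * |η| := by ring
          _ ≤ K * |η| ^ n * (M * |R η|) := by gcongr
          _ = 2 * M * K * |η| ^ n * (|R η| * (1 / 2)) := by ring
          _ ≤ _ := by gcongr

theorem cos_mul_sub_isBigO {α : Type*} {l : Filter α} {s u η : α → ℝ} (hη : Tendsto η l (nhds 0))
    (hs : s =O[l] η) (hu : u =O[l] η) {F : ℝ → ℝ} {m : ℝ}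
    (hF : (fun x => F x - m) =O[nhds 0] fun x => x) :
    (fun x => cos (u x) * F (s x) - m) =O[l] η := by
  have hFs : (fun x => F (s x) - m) =O[l] η := (hF.comp_tendsto (hs.trans_tendsto hη)).trans hs
  have hcos : (fun x => cos x - 1) =O[nhds 0] fun x => x := by
    simpa using (hasDerivAt_cos 0).isBigO_sub
  have hcu : (fun x => cos (u x) - 1) =O[l] η := (hcos.comp_tendsto (hu.trans_tendsto hη)).trans hu
  have hb : (fun x => cos (u x)) =O[l] fun _ => (1 : ℝ) :=
    IsBigO.of_bound 1 (Eventually.of_forall fun x => by simpa using abs_cos_le_one (u x))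
  have h1 : (fun x => cos (u x) * (F (s x) - m)) =O[l] η := by simpa using hb.mul hFs
  exact (h1.add (hcu.const_mul_left m)).congr_left fun x => by ring

theorem arctan_chord_sub_isBigO (t f : ℕ → ℝ) (a b c c₁ c₃ d : ℝ) (hf₀ : f 0 ≠ 0)
    (hc₁ : c₁ = t 1 / 2)
    (hc₃ : f 0 * c₃ = f 0 * t 3 / 4 + f 1 * t 2 / 4 + f 2 * t 1 / 12
      + f 0 * (t 1 * b / 2 + t 2 * a))
    (hd : f 0 * d = f 0 * t 1 * c / 2 + f 0 * t 4 / 5 - f 0 * t 2 * t 1 ^ 2 / 60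
      + f 1 * (t 3 / 5 - (c₃ - t 1 * b / 2 - t 2 * a) / 2 - t 1 ^ 3 / 480) + f 2 * t 2 / 5
      + 3 * f 3 * t 1 / 40)
    (h₁ : 4 * f 0 * t 2 + f 1 * t 1 = 0)
    (h₂ : 3 * f 1 * t 2 + 6 * f 0 * t 3 + f 2 * t 1 = 0)
    {D F σ : ℝ → ℝ} (hDc : Continuous D) (hFc : Continuous F)
    (hD : (fun x => D x - (t 1 * x + t 2 * x ^ 2 + t 3 * x ^ 3 + t 4 * x ^ 4))
      =O[nhds 0] fun x => x ^ 5)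
    (hF : (fun x => F x - (f 0 + f 1 * x + f 2 * x ^ 2 + f 3 * x ^ 3)) =O[nhds 0] fun x => x ^ 4)
    (hσ : (fun η => σ η - (η + a * η ^ 2 + b * η ^ 3 + c * η ^ 4)) =O[nhds 0] fun η => η ^ 5) :
    (fun η => arctan ((∫ s in a * η ^ 2..σ η, sin (D s - D (a * η ^ 2)) * F s)
        / ∫ s in a * η ^ 2..σ η, cos (D s - D (a * η ^ 2)) * F s)
      - (c₁ * η + c₃ * η ^ 3 + d * η ^ 4)) =O[nhds 0] fun η => η ^ 5 := by
  have hid : Tendsto (fun η : ℝ => η) (nhds 0) (nhds 0) := tendsto_id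
  have hpow {j : ℕ} (k : ℕ) (hk : k ≤ j) : (fun η : ℝ => η ^ j) =O[nhds 0] fun η => η ^ k :=
    isBigO_pow_of_le hid (isBigO_refl _ _) hk
  have hlin {j : ℕ} (hj : 1 ≤ j) : (fun η : ℝ => η ^ j) =O[nhds 0] fun η => η := by
    simpa using hpow 1 hj
  have hσ0 : σ 0 = 0 := by
    have := hσ.eq_zero_imp.self_of_nhds
    simpa using this
  have hσ2 : (fun η => σ η - a * η ^ 2 - η) =O[nhds 0] fun η => η ^ 2 := by
    refine ((isBigO_pow_of_le hid hσ (k := 2) (by norm_num)).add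
      (((hpow 2 (j := 3) (by norm_num)).const_mul_left b).add
      ((hpow 2 (j := 4) (by norm_num)).const_mul_left c))).congr_left fun η => by ring
  have hbound {τ : ℝ → ℝ} {m : ℝ} (hm : |m| < 2)
      (h : (fun η => τ η - m * η) =O[nhds 0] fun η => η ^ 2) :
      ∀ᶠ η in nhds (0 : ℝ), |τ η| ≤ 2 * |η| := by
    have h' := (h.trans_isLittleO (isLittleO_pow_id one_lt_two)).def (sub_pos.2 hm)
    filter_upwards [h'] with η hη
    simp only [norm_eq_abs] at hη
    calc |τ η| = |(τ η - m * η) + m * η| := by ring_nf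
      _ ≤ |τ η - m * η| + |m * η| := abs_add_le _ _
      _ ≤ (2 - |m|) * |η| + |m| * |η| := by rw [abs_mul]; gcongr
      _ = 2 * |η| := by ring
  have hα : ∀ᶠ η in nhds (0 : ℝ), |a * η ^ 2| ≤ 2 * |η| :=
    hbound (m := 0) (by norm_num) (((hpow 2 le_rfl).const_mul_left a).congr_left fun η => by ring)
  have hβ : ∀ᶠ η in nhds (0 : ℝ), |σ η| ≤ 2 * |η| :=
    hbound (m := 1) (by norm_num) ((hσ2.add ((hpow 2 le_rfl).const_mul_left a)).congr_left
      fun η => by ring)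
  have hsnd2 : (fun p : ℝ × ℝ => a * p.2 ^ 2) =O[coneFilter] Prod.snd :=
    ((hlin one_le_two).const_mul_left a).comp_tendsto tendsto_snd_coneFilter
  have hDO : D =O[nhds 0] fun x => x := by
    refine (((((hD.trans (hlin (by norm_num))).add ((isBigO_refl _ _).const_mul_left (t 1))).add
      ((hlin one_le_two).const_mul_left (t 2))).add
      ((hlin (j := 3) (by norm_num)).const_mul_left (t 3))).add
      ((hlin (j := 4) (by norm_num)).const_mul_left (t 4))).congr_left fun x => by ring
  have hFO : (fun x => F x - f 0) =O[nhds 0] fun x => x := by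
    refine ((((hF.trans (hlin (by norm_num))).add ((isBigO_refl _ _).const_mul_left (f 1))).add
      ((hlin one_le_two).const_mul_left (f 2))).add
      ((hlin (j := 3) (by norm_num)).const_mul_left (f 3))).congr_left fun x => by ring
  have hu : (fun p : ℝ × ℝ => D p.1 - D (a * p.2 ^ 2)) =O[coneFilter] Prod.snd :=
    ((hDO.comp_tendsto (fst_isBigO_snd_coneFilter.trans_tendsto tendsto_snd_coneFilter)).trans
      fst_isBigO_snd_coneFilter).sub
      ((hDO.comp_tendsto (hsnd2.trans_tendsto tendsto_snd_coneFilter)).trans hsnd2)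
  have hT : Tendsto (fun η : ℝ => c₁ * η + c₃ * η ^ 3 + d * η ^ 4) (nhds 0) (nhds 0) := by
    have : Continuous fun η : ℝ => c₁ * η + c₃ * η ^ 3 + d * η ^ 4 := by fun_prop
    simpa using this.tendsto 0
  refine arctan_div_sub_isBigO (T := fun η : ℝ => c₁ * η + c₃ * η ^ 3 + d * η ^ 4) hT (by simp) ?_
    (by simp [hσ0]) ?_
  · have h0 : (fun η => ∫ s in a * η ^ 2..σ η, (cos (D s - D (a * η ^ 2)) * F s - f 0))
        =O[nhds 0] fun η => η ^ (1 + 1) :=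
      integral_isBigO_of_coneFilter (g := fun s η => cos (D s - D (a * η ^ 2)) * F s - f 0)
        (by simpa using cos_mul_sub_isBigO tendsto_snd_coneFilter fst_isBigO_snd_coneFilter hu hFO)
        hα hβ
    have h1 : (fun η => (∫ s in a * η ^ 2..σ η, cos (D s - D (a * η ^ 2)) * F s) - f 0 * η)
        =O[nhds 0] fun η => η ^ 2 := by
      refine (h0.add (hσ2.const_mul_left (f 0))).congr_left fun η => ?_
      rw [intervalIntegral.integral_sub (Continuous.intervalIntegrable (by fun_prop) _ _)
        intervalIntegrable_const, intervalIntegral.integral_const, smul_eq_mul]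
      ring
    have h2 : IsEquivalent (nhds 0)
        (fun η => ∫ s in a * η ^ 2..σ η, cos (D s - D (a * η ^ 2)) * F s) fun η => f 0 * η :=
      (h1.trans_isLittleO (isLittleO_pow_id one_lt_two)).trans_isBigO
        ((isBigO_refl _ _).const_mul_right hf₀ |>.congr_left fun _ => rfl)
    exact ((isBigO_refl (fun η : ℝ => η) (nhds 0)).const_mul_right hf₀).trans h2.isBigO_symm
  · set r : ℝ → ℝ := fun η => σ η - (η + a * η ^ 2 + b * η ^ 3 + c * η ^ 4) with hr
    have hc' : (fun η => c + r η * (η ^ 4)⁻¹ - c) =O[nhds 0] fun η => η := by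
      refine (hσ.mul (isBigO_refl (fun η : ℝ => (η ^ 4)⁻¹) (nhds 0))).congr (fun η => ?_) fun η => ?_
      · ring
      · rcases eq_or_ne η 0 with rfl | h
        · simp
        · field_simp
    have hmain := gradedPoly_chordCoeff_sub_isBigO t f a b c c₁ c₃ d hc₁ hc₃ hd h₁ h₂ _ hc'
    have herr := integral_isBigO_of_coneFilter (g := fun s η =>
      sin (D s - D (a * η ^ 2) - (c₁ * η + c₃ * η ^ 3 + d * η ^ 4)) * F s
        - chordIntegrand t f a c₁ c₃ d s η)
      (sin_mul_sub_chordIntegrand_isBigO tendsto_snd_coneFilter fst_isBigO_snd_coneFilter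
        t f a c₁ c₃ d hD hF) hα hβ
    refine (herr.add hmain).congr_left fun η => ?_
    have hσe : η + a * η ^ 2 + b * η ^ 3 + (c + r η * (η ^ 4)⁻¹) * η ^ 4 = σ η := by
      rcases eq_or_ne η 0 with rfl | h
      · simp [hσ0]
      · simp only [hr]; field_simp; ring
    have hcont : Continuous fun s => chordIntegrand t f a c₁ c₃ d s η := by
      unfold chordIntegrand; fun_prop
    rw [hσe, ← intervalIntegral.integral_eq_sub_of_hasDerivAt
      (fun s _ => hasDerivAt_gradedPoly_chordCoeff t f a c₁ c₃ d s η)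
      (hcont.intervalIntegrable _ _),
      intervalIntegral.integral_sub (Continuous.intervalIntegrable (by fun_prop) _ _)
        (hcont.intervalIntegrable _ _), sub_add_cancel, ← intervalIntegral.integral_mul_const,
      ← intervalIntegral.integral_mul_const, ← intervalIntegral.integral_sub
        (Continuous.intervalIntegrable (by fun_prop) _ _)
        (Continuous.intervalIntegrable (by fun_prop) _ _)]
    refine intervalIntegral.integral_congr fun s _ => ?_
    simp only [sin_sub (D s - D (a * η ^ 2))]
    ring

theorem sub_taylorSum_isBigO {f : ℝ → ℝ} {n : ℕ} (hf : ContDiff ℝ (n + 1 : ℕ) f) (ξ : ℝ) :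
    (fun s => f (ξ + s) - ∑ i ∈ Finset.range (n + 1), iteratedDeriv i f ξ / i.factorial * s ^ i)
      =O[nhds 0] fun s => s ^ (n + 1) := by
  have htend : Tendsto (fun s => ξ + s) (nhds 0) (nhds ξ) := by
    simpa using (continuous_const_add ξ).tendsto 0
  have h1 := ((taylor_isLittleO_univ (x₀ := ξ) hf).comp_tendsto htend).isBigO
  simp only [Function.comp_def, add_sub_cancel_left] at h1
  refine (h1.add ((isBigO_refl (fun s : ℝ => s ^ (n + 1)) (nhds 0)).const_mul_left
    (iteratedDeriv (n + 1) f ξ / (n + 1).factorial))).congr_left fun s => ?_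
  rw [taylor_within_apply, Finset.sum_range_succ]
  simp only [iteratedDerivWithin_univ, add_sub_cancel_left, smul_eq_mul]
  rw [Finset.sum_congr rfl fun i _ => show ((i.factorial : ℝ)⁻¹ * s ^ i) * iteratedDeriv i f ξ
    = iteratedDeriv i f ξ / i.factorial * s ^ i by ring]
  ring

theorem deriv_pow_three {w w₁ w₂ w₃ : ℝ → ℝ} (h₁ : ∀ x, HasDerivAt w (w₁ x) x)
    (h₂ : ∀ x, HasDerivAt w₁ (w₂ x) x) (h₃ : ∀ x, HasDerivAt w₂ (w₃ x) x) :
    (deriv (fun x => w x ^ 3) = fun x => 3 * w x ^ 2 * w₁ x) ∧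
    (deriv (fun x => 3 * w x ^ 2 * w₁ x) = fun x => 6 * w x * w₁ x ^ 2 + 3 * w x ^ 2 * w₂ x) ∧
    deriv (fun x => 6 * w x * w₁ x ^ 2 + 3 * w x ^ 2 * w₂ x)
      = fun x => 6 * w₁ x ^ 3 + 18 * w x * w₁ x * w₂ x + 3 * w x ^ 2 * w₃ x := by
  refine ⟨funext fun x => ?_, funext fun x => ?_, funext fun x => ?_⟩
  · exact ((h₁ x).fun_pow 3).deriv.trans (by norm_num)
  · exact ((((h₁ x).fun_pow 2).const_mul 3).fun_mul (h₂ x)).deriv.trans (by push_cast; ring)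
  · exact ((((h₁ x).const_mul 6).fun_mul ((h₂ x).fun_pow 2)).fun_add
      ((((h₁ x).fun_pow 2).const_mul 3).fun_mul (h₃ x))).deriv.trans (by push_cast; ring)

theorem iteratedDeriv_sq {w w₁ w₂ w₃ : ℝ → ℝ} (h₁ : ∀ x, HasDerivAt w (w₁ x) x)
    (h₂ : ∀ x, HasDerivAt w₁ (w₂ x) x) (h₃ : ∀ x, HasDerivAt w₂ (w₃ x) x) :
    (iteratedDeriv 1 (fun x => w x ^ 2) = fun x => 2 * w x * w₁ x) ∧
    (iteratedDeriv 2 (fun x => w x ^ 2) = fun x => 2 * w₁ x ^ 2 + 2 * w x * w₂ x) ∧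
    iteratedDeriv 3 (fun x => w x ^ 2) = fun x => 6 * w₁ x * w₂ x + 2 * w x * w₃ x := by
  have e1 : iteratedDeriv 1 (fun x => w x ^ 2) = fun x => 2 * w x * w₁ x := by
    rw [iteratedDeriv_one]
    exact funext fun x => ((h₁ x).fun_pow 2).deriv.trans (by norm_num)
  have e2 : iteratedDeriv 2 (fun x => w x ^ 2) = fun x => 2 * w₁ x ^ 2 + 2 * w x * w₂ x := by
    rw [iteratedDeriv_succ, e1]
    exact funext fun x => (((h₁ x).const_mul 2).fun_mul (h₂ x)).deriv.trans (by ring)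
  refine ⟨e1, e2, ?_⟩
  rw [iteratedDeriv_succ, e2]
  exact funext fun x => ((((h₂ x).fun_pow 2).const_mul 2).fun_add
    (((h₁ x).const_mul 2).fun_mul (h₃ x))).deriv.trans (by push_cast; ring)

theorem iteratedDeriv_of_hasDerivAt_inv {C : ℝ} (hC : C ≠ 0) {θ w w₁ w₂ w₃ : ℝ → ℝ}
    (hw : ∀ x, w x ≠ 0) (hθ : ∀ x, HasDerivAt θ ((w x)⁻¹ / C) x)
    (h₁ : ∀ x, HasDerivAt w (w₁ x) x)
    (h₂ : ∀ x, HasDerivAt w₁ (w₂ x) x) (h₃ : ∀ x, HasDerivAt w₂ (w₃ x) x) :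
    (iteratedDeriv 1 θ = fun x => (w x)⁻¹ / C) ∧
    (iteratedDeriv 2 θ = fun x => -w₁ x / w x ^ 2 / C) ∧
    (iteratedDeriv 3 θ = fun x => (2 * w₁ x ^ 2 - w x * w₂ x) / w x ^ 3 / C) ∧
    iteratedDeriv 4 θ = fun x =>
      (6 * w x * w₁ x * w₂ x - 6 * w₁ x ^ 3 - w x ^ 2 * w₃ x) / w x ^ 4 / C := by
  have e1 : iteratedDeriv 1 θ = fun x => (w x)⁻¹ / C := by
    rw [iteratedDeriv_one]
    exact funext fun x => (hθ x).deriv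
  have e2 : iteratedDeriv 2 θ = fun x => -w₁ x / w x ^ 2 / C := by
    rw [iteratedDeriv_succ, e1]
    exact funext fun x => (((h₁ x).fun_inv (hw x)).div_const C).deriv
  have e3 : iteratedDeriv 3 θ = fun x => (2 * w₁ x ^ 2 - w x * w₂ x) / w x ^ 3 / C := by
    rw [iteratedDeriv_succ, e2]
    refine funext fun x => (((h₂ x).fun_neg.fun_div ((h₁ x).fun_pow 2)
      (pow_ne_zero 2 (hw x))).div_const C).deriv.trans ?_
    have := hw x
    field_simp
    push_cast
    ring
  refine ⟨e1, e2, e3, ?_⟩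
  rw [iteratedDeriv_succ, e3]
  refine funext fun x => ((((((h₂ x).fun_pow 2).const_mul 2).fun_sub
    ((h₁ x).fun_mul (h₃ x))).fun_div ((h₁ x).fun_pow 3)
    (pow_ne_zero 3 (hw x))).div_const C).deriv.trans ?_
  have := hw x
  field_simp
  push_cast
  ring

theorem re_im_integral_exp_mul {D F : ℝ → ℝ} (hD : Continuous D) (hF : Continuous F) (α β : ℝ) :
    (∫ s in α..β, Complex.exp (Complex.I * (D s : ℂ)) * (F s : ℂ)).re
        = ∫ s in α..β, cos (D s) * F s ∧
    (∫ s in α..β, Complex.exp (Complex.I * (D s : ℂ)) * (F s : ℂ)).im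
        = ∫ s in α..β, sin (D s) * F s := by
  have hint : IntervalIntegrable
      (fun s => Complex.exp (Complex.I * (D s : ℂ)) * (F s : ℂ)) MeasureTheory.volume α β :=
    Continuous.intervalIntegrable (by fun_prop) _ _
  constructor
  · refine (Complex.reCLM.intervalIntegral_comp_comm hint).symm.trans
      (intervalIntegral.integral_congr fun s _ => ?_)
    simp [mul_comm Complex.I, Complex.exp_ofReal_mul_I_re, Complex.exp_ofReal_mul_I_im]
  · refine (Complex.imCLM.intervalIntegral_comp_comm hint).symm.trans
      (intervalIntegral.integral_congr fun s _ => ?_)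
    simp [mul_comm Complex.I, Complex.exp_ofReal_mul_I_re, Complex.exp_ofReal_mul_I_im]

/-- Lemma P:alpha: the angle `Φ⁺(η) = arctan(Im G(η) / Re G(η))` of the chord
admits an expansion `c₁η + c₃η³ + Φ₄η⁴ + O(η⁵)` (no `η²` term), where
`Φ₄ = (1/(4Cρ^{1/3}))·(A'' + (8/135)(ρ'/ρ)³ - (11/135)ρ'ρ''/ρ²
      + (1/45)ρ'''/ρ + (1/(180C²))ρ'/ρ^{5/3})`. -/
theorem stmt_15 (C : ℝ) (hC : 0 < C) (ρ : ℝ → ℝ) (hρ : ContDiff ℝ 8 ρ)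
    (hpos : ∀ x, 0 < ρ x) (θ : ℝ → ℝ)
    (hθ : ∀ x, HasDerivAt θ (ρ x ^ (-(1:ℝ)/3) / C) x)
    (A : ℝ → ℝ) (hA : ContDiff ℝ 3 A) (ξ : ℝ)
    (x₀ xp : ℝ → ℝ)
    (hx₀ : ∀ η, x₀ η = ξ + A ξ * η^2)
    (hxp : ∀ η, xp η = ξ + η + A (ξ + η) * η^2)
    (G : ℝ → ℂ)
    (hG : ∀ η, G η = ∫ x in (x₀ η)..(xp η),
      Complex.exp (Complex.I * ((θ x - θ (x₀ η) : ℝ) : ℂ)) *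
        ((ρ x ^ ((2:ℝ)/3) : ℝ) : ℂ))
    (Φ : ℝ → ℝ) (hΦ : ∀ η, Φ η = Real.arctan ((G η).im / (G η).re))
    (hΦ0 : Φ 0 = 0) :
    ∃ c₁ c₃ : ℝ,
      (fun η : ℝ => Φ η - (c₁ * η + c₃ * η^3
        + ((1 / (4 * C * ρ ξ ^ ((1:ℝ)/3))) *
            (deriv (deriv A) ξ
              + (8/135) * (deriv ρ ξ / ρ ξ)^3
              - (11/135) * (deriv ρ ξ * deriv (deriv ρ) ξ / (ρ ξ)^2)
              + (1/45) * (deriv (deriv (deriv ρ)) ξ / ρ ξ)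
              + (1/(180 * C^2)) * (deriv ρ ξ / ρ ξ ^ ((5:ℝ)/3)))) * η^4))
        =O[nhds 0] (fun η : ℝ => η^5) := by
  obtain ⟨w, hw⟩ : ∃ w : ℝ → ℝ, ∀ x, w x = ρ x ^ ((1 : ℝ) / 3) := ⟨_, fun _ => rfl⟩
  have hwpos (x : ℝ) : 0 < w x := by rw [hw]; exact rpow_pos_of_pos (hpos x) _
  have hwne (x : ℝ) : w x ≠ 0 := (hwpos x).ne'
  have hwpow (x : ℝ) (n : ℕ) : ρ x ^ ((n : ℝ) / 3) = w x ^ n := by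
    rw [hw, ← rpow_natCast, ← rpow_mul (hpos x).le]
    congr 1
    ring
  have hρw : ρ = fun x => w x ^ 3 := funext fun x => by
    rw [← hwpow x 3]
    norm_num
  have hwneg (x : ℝ) : ρ x ^ (-(1 : ℝ) / 3) = (w x)⁻¹ := by
    rw [hw, ← rpow_neg (hpos x).le]
    congr 1
    ring
  have hwC : ContDiff ℝ 8 w := by
    rw [funext hw]
    exact hρ.rpow_const_of_ne fun x => (hpos x).ne'
  have hwd {k n : ℕ} {g : ℝ → ℝ} (hg : ContDiff ℝ (k + n : ℕ) g) (hk : 1 ≤ k) (x : ℝ) :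
      HasDerivAt (iteratedDeriv n g) (iteratedDeriv (n + 1) g x) x := by
    rw [iteratedDeriv_succ]
    exact ((hg.differentiable_iteratedDeriv n
      (by exact_mod_cast (by omega : n < k + n))) x).hasDerivAt
  have h₁ (x : ℝ) : HasDerivAt w (iteratedDeriv 1 w x) x := by
    simpa using hwd (k := 8) (n := 0) hwC (by norm_num) x
  have h₂ := hwd (k := 7) (n := 1) hwC (by norm_num)
  have h₃ := hwd (k := 6) (n := 2) hwC (by norm_num)
  set w₁ := iteratedDeriv 1 w
  set w₂ := iteratedDeriv 2 w
  set w₃ := iteratedDeriv 3 w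
  have hθw (x : ℝ) : HasDerivAt θ ((w x)⁻¹ / C) x := hwneg x ▸ hθ x
  have hθC : ContDiff ℝ (4 + 1 : ℕ) θ := by
    refine (contDiff_succ_iff_deriv (n := 4)).2 ⟨fun x => (hθw x).differentiableAt, by simp, ?_⟩
    rw [funext fun x => (hθw x).deriv]
    exact ((hwC.of_le (by norm_num)).inv hwne).div_const C
  have hfC : ContDiff ℝ (3 + 1 : ℕ) fun x => w x ^ 2 := (hwC.pow 2).of_le (by norm_num)
  obtain ⟨d1, d2, d3⟩ := deriv_pow_three h₁ h₂ h₃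
  obtain ⟨f1, f2, f3⟩ := iteratedDeriv_sq h₁ h₂ h₃
  obtain ⟨t1, t2, t3, t4⟩ := iteratedDeriv_of_hasDerivAt_inv hC.ne' hwne hθw h₁ h₂ h₃
  have hD := sub_taylorSum_isBigO hθC ξ
  have hF := sub_taylorSum_isBigO hfC ξ
  have hAT := sub_taylorSum_isBigO (n := 2) (f := A) hA ξ
  set t : ℕ → ℝ := fun i => iteratedDeriv i θ ξ / i.factorial with ht
  set f : ℕ → ℝ := fun i => iteratedDeriv i (fun x => w x ^ 2) ξ / i.factorial with hf
  have hA2 : iteratedDeriv 2 A = deriv (deriv A) := by rw [iteratedDeriv_succ, iteratedDeriv_one]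
  set a := A ξ
  set b := deriv A ξ
  set c := deriv (deriv A) ξ / 2 with hc
  have et1 : t 1 = (w ξ)⁻¹ / C := by simp [ht, t1]
  have et2 : t 2 = -w₁ ξ / w ξ ^ 2 / C / 2 := by simp [ht, t2]
  have et3 : t 3 = (2 * w₁ ξ ^ 2 - w ξ * w₂ ξ) / w ξ ^ 3 / C / 6 := by
    simp [ht, t3, Nat.factorial]
  have et4 : t 4 = (6 * w ξ * w₁ ξ * w₂ ξ - 6 * w₁ ξ ^ 3 - w ξ ^ 2 * w₃ ξ) / w ξ ^ 4 / C / 24 := by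
    simp [ht, t4, Nat.factorial]
  have ef0 : f 0 = w ξ ^ 2 := by simp [hf]
  have ef1 : f 1 = 2 * w ξ * w₁ ξ := by simp [hf, f1]
  have ef2 : f 2 = (2 * w₁ ξ ^ 2 + 2 * w ξ * w₂ ξ) / 2 := by simp [hf, f2]
  have ef3 : f 3 = (6 * w₁ ξ * w₂ ξ + 2 * w ξ * w₃ ξ) / 6 := by simp [hf, f3, Nat.factorial]
  have hwξ := hwne ξ
  have hf0 : f 0 ≠ 0 := by rw [ef0]; exact pow_ne_zero 2 hwξ
  refine ⟨t 1 / 2, t 3 / 4 + (f 1 * t 2 / 4 + f 2 * t 1 / 12) / f 0 + (t 1 * b / 2 + t 2 * a), ?_⟩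
  have hθcont : Continuous θ := hθC.continuous
  have hwcont : Continuous w := hwC.continuous
  have key := arctan_chord_sub_isBigO t f a b c (t 1 / 2)
    (t 3 / 4 + (f 1 * t 2 / 4 + f 2 * t 1 / 12) / f 0 + (t 1 * b / 2 + t 2 * a))
    ((1 / (4 * C * ρ ξ ^ ((1:ℝ)/3))) *
            (deriv (deriv A) ξ
              + (8/135) * (deriv ρ ξ / ρ ξ)^3
              - (11/135) * (deriv ρ ξ * deriv (deriv ρ) ξ / (ρ ξ)^2)
              + (1/45) * (deriv (deriv (deriv ρ)) ξ / ρ ξ)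
              + (1/(180 * C^2)) * (deriv ρ ξ / ρ ξ ^ ((5:ℝ)/3)))) hf0 rfl
    (by field_simp; ring)
    (by
      have h5 : ρ ξ ^ ((5 : ℝ) / 3) = w ξ ^ 5 := hwpow ξ 5
      rw [h5, ← hw, hρw, d1, d2, d3, et1, et2, et3, et4, ef0, ef1, ef2, ef3, hc]
      field_simp
      ring)
    (by rw [et1, et2, ef0, ef1]; field_simp; ring)
    (by rw [et1, et2, et3, ef0, ef1, ef2]; field_simp; ring)
    (D := fun s => θ (ξ + s) - θ ξ) (F := fun s => w (ξ + s) ^ 2)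
    (σ := fun η => η + A (ξ + η) * η ^ 2) (by fun_prop) (by fun_prop)
    (hD.congr_left fun s => by
      simp [Finset.sum_range_succ, ht]; ring)
    (hF.congr_left fun s => by
      simp [Finset.sum_range_succ, hf])
    ((hAT.mul (isBigO_refl (fun η : ℝ => η ^ 2) (nhds 0))).congr (fun η => by
      simp [Finset.sum_range_succ, hA2, a, b, c]; ring) fun η => by ring)
  refine key.congr_left fun η => ?_
  have hGη : G η = ∫ s in a * η ^ 2..η + A (ξ + η) * η ^ 2,
      Complex.exp (Complex.I * ((θ (ξ + s) - θ ξ - (θ (ξ + a * η ^ 2) - θ ξ) : ℝ) : ℂ))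
        * ((w (ξ + s) ^ 2 : ℝ) : ℂ) := by
    have h2 (x : ℝ) : ρ x ^ ((2 : ℝ) / 3) = w x ^ 2 := hwpow x 2
    rw [hG, hx₀, hxp, add_assoc ξ η, ← intervalIntegral.integral_comp_add_left _ ξ]
    simp only [h2, sub_sub_sub_cancel_right]
  obtain ⟨hre, him⟩ := re_im_integral_exp_mul
    (D := fun s => θ (ξ + s) - θ ξ - (θ (ξ + a * η ^ 2) - θ ξ)) (F := fun s => w (ξ + s) ^ 2)
    (by fun_prop) (by fun_prop) (a * η ^ 2) (η + A (ξ + η) * η ^ 2)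
  rw [hΦ, hGη, hre, him]
end
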